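/- For every vector Y ∈ ℝ⁸ there exists a matrix B ∈ N = span_ℝ{[Jᵢ,Jⱼ] : 1 ≤ i < j ≤ 7} such that [B, J₄] = 0 and B·Y = J₄·Y. -/

import Mathlib

open Matrix

noncomputable section

/-- The Clifford map `J_{Z₁}` of the pseudo H-type Lie algebra `n_{3,4}`. -/
def J1 : Matrix (Fin 8) (Fin 8) ℝ :=
  !![0,-1,0,0,0,0,0,0;
     1,0,0,0,0,0,0,0;
     0,0,0,1,0,0,0,0;
     0,0,-1,0,0,0,0,0;
     0,0,0,0,0,0,0,1;
     0,0,0,0,0,0,1,0;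
     0,0,0,0,0,-1,0,0;
     0,0,0,0,-1,0,0,0]

/-- The Clifford map `J_{Z₂}`. -/
def J2 : Matrix (Fin 8) (Fin 8) ℝ :=
  !![0,0,-1,0,0,0,0,0;
     0,0,0,-1,0,0,0,0;
     1,0,0,0,0,0,0,0;
     0,1,0,0,0,0,0,0;
     0,0,0,0,0,0,1,0;
     0,0,0,0,0,0,0,-1;
     0,0,0,0,-1,0,0,0;
     0,0,0,0,0,1,0,0]

/-- The Clifford map `J_{Z₃}`. -/
def J3 : Matrix (Fin 8) (Fin 8) ℝ :=
  !![0,0,0,-1,0,0,0,0;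
     0,0,1,0,0,0,0,0;
     0,-1,0,0,0,0,0,0;
     1,0,0,0,0,0,0,0;
     0,0,0,0,0,1,0,0;
     0,0,0,0,-1,0,0,0;
     0,0,0,0,0,0,0,1;
     0,0,0,0,0,0,-1,0]

/-- The Clifford map `J_{Z₄}`. -/
def J4 : Matrix (Fin 8) (Fin 8) ℝ :=
  !![0,0,0,0,1,0,0,0;
     0,0,0,0,0,0,0,1;
     0,0,0,0,0,0,1,0;
     0,0,0,0,0,1,0,0;
     1,0,0,0,0,0,0,0;
     0,0,0,1,0,0,0,0;
     0,0,1,0,0,0,0,0;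
     0,1,0,0,0,0,0,0]

/-- The Clifford map `J_{Z₅}`. -/
def J5 : Matrix (Fin 8) (Fin 8) ℝ :=
  !![0,0,0,0,0,1,0,0;
     0,0,0,0,0,0,1,0;
     0,0,0,0,0,0,0,-1;
     0,0,0,0,-1,0,0,0;
     0,0,0,-1,0,0,0,0;
     1,0,0,0,0,0,0,0;
     0,1,0,0,0,0,0,0;
     0,0,-1,0,0,0,0,0]

/-- The Clifford map `J_{Z₆}`. -/
def J6 : Matrix (Fin 8) (Fin 8) ℝ :=
  !![0,0,0,0,0,0,1,0;
     0,0,0,0,0,-1,0,0;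
     0,0,0,0,-1,0,0,0;
     0,0,0,0,0,0,0,1;
     0,0,-1,0,0,0,0,0;
     0,-1,0,0,0,0,0,0;
     1,0,0,0,0,0,0,0;
     0,0,0,1,0,0,0,0]

/-- The Clifford map `J_{Z₇}`. -/
def J7 : Matrix (Fin 8) (Fin 8) ℝ :=
  !![0,0,0,0,0,0,0,1;
     0,0,0,0,-1,0,0,0;
     0,0,0,0,0,1,0,0;
     0,0,0,0,0,0,-1,0;
     0,-1,0,0,0,0,0,0;
     0,0,1,0,0,0,0,0;
     0,0,0,-1,0,0,0,0;
     1,0,0,0,0,0,0,0]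

/-- The family `J₁, …, J₇`. -/
def J : Fin 7 → Matrix (Fin 8) (Fin 8) ℝ := ![J1, J2, J3, J4, J5, J6, J7]

/-- `N = span ℝ {[Jᵢ, Jⱼ] : 1 ≤ i < j ≤ 7}`, the normalizer of `V = span {J₁,…,J₇}`
in `so(4,4)`. -/
def NN : Submodule ℝ (Matrix (Fin 8) (Fin 8) ℝ) :=
  Submodule.span ℝ {M | ∃ i j : Fin 7, i < j ∧ M = J i * J j - J j * J i}

/-- Integer versions of the Clifford maps. -/
def JZ : Fin 7 → Matrix (Fin 8) (Fin 8) ℤ := ![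
  !![0,-1,0,0,0,0,0,0;
     1,0,0,0,0,0,0,0;
     0,0,0,1,0,0,0,0;
     0,0,-1,0,0,0,0,0;
     0,0,0,0,0,0,0,1;
     0,0,0,0,0,0,1,0;
     0,0,0,0,0,-1,0,0;
     0,0,0,0,-1,0,0,0],
  !![0,0,-1,0,0,0,0,0;
     0,0,0,-1,0,0,0,0;
     1,0,0,0,0,0,0,0;
     0,1,0,0,0,0,0,0;
     0,0,0,0,0,0,1,0;
     0,0,0,0,0,0,0,-1;
     0,0,0,0,-1,0,0,0;
     0,0,0,0,0,1,0,0],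
  !![0,0,0,-1,0,0,0,0;
     0,0,1,0,0,0,0,0;
     0,-1,0,0,0,0,0,0;
     1,0,0,0,0,0,0,0;
     0,0,0,0,0,1,0,0;
     0,0,0,0,-1,0,0,0;
     0,0,0,0,0,0,0,1;
     0,0,0,0,0,0,-1,0],
  !![0,0,0,0,1,0,0,0;
     0,0,0,0,0,0,0,1;
     0,0,0,0,0,0,1,0;
     0,0,0,0,0,1,0,0;
     1,0,0,0,0,0,0,0;
     0,0,0,1,0,0,0,0;
     0,0,1,0,0,0,0,0;
     0,1,0,0,0,0,0,0],
  !![0,0,0,0,0,1,0,0;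
     0,0,0,0,0,0,1,0;
     0,0,0,0,0,0,0,-1;
     0,0,0,0,-1,0,0,0;
     0,0,0,-1,0,0,0,0;
     1,0,0,0,0,0,0,0;
     0,1,0,0,0,0,0,0;
     0,0,-1,0,0,0,0,0],
  !![0,0,0,0,0,0,1,0;
     0,0,0,0,0,-1,0,0;
     0,0,0,0,-1,0,0,0;
     0,0,0,0,0,0,0,1;
     0,0,-1,0,0,0,0,0;
     0,-1,0,0,0,0,0,0;
     1,0,0,0,0,0,0,0;
     0,0,0,1,0,0,0,0],
  !![0,0,0,0,0,0,0,1;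
     0,0,0,0,-1,0,0,0;
     0,0,0,0,0,1,0,0;
     0,0,0,0,0,0,-1,0;
     0,-1,0,0,0,0,0,0;
     0,0,1,0,0,0,0,0;
     0,0,0,-1,0,0,0,0;
     1,0,0,0,0,0,0,0]]

def TT : Fin 4 → Fin 4 → List (ℤ × Fin 7 × Fin 7) :=
  ![![[(2, 0, 6), (2, 1, 5)],
      [(1, 1, 2), (1, 1, 4), (-1, 2, 5), (-1, 4, 5)],
      [(-1, 0, 2), (-1, 0, 4), (1, 2, 6), (1, 4, 6)],
      [(1, 0, 1), (1, 0, 5), (-1, 1, 6), (-1, 5, 6)]],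
    ![[(-1, 1, 2), (1, 1, 4), (-1, 2, 5), (1, 4, 5)],
      [(2, 0, 6), (-2, 2, 4)],
      [(-1, 0, 1), (1, 0, 5), (1, 1, 6), (-1, 5, 6)],
      [(-1, 0, 2), (1, 0, 4), (1, 2, 6), (-1, 4, 6)]],
    ![[(1, 0, 2), (-1, 0, 4), (1, 2, 6), (-1, 4, 6)],
      [(1, 0, 1), (1, 0, 5), (1, 1, 6), (1, 5, 6)],
      [(2, 1, 5), (-2, 2, 4)],
      [(-1, 1, 2), (1, 1, 4), (1, 2, 5), (-1, 4, 5)]],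
    ![[(-1, 0, 1), (1, 0, 5), (-1, 1, 6), (1, 5, 6)],
      [(1, 0, 2), (1, 0, 4), (1, 2, 6), (1, 4, 6)],
      [(1, 1, 2), (1, 1, 4), (1, 2, 5), (1, 4, 5)],
      []]]

def pp : Fin 8 → Fin 4 := ![0, 1, 2, 3, 0, 3, 2, 1]
def ss : Fin 8 → ℤ := ![1, 1, 1, 1, -1, -1, -1, -1]

/-- Matrix units on the `+1` eigenspace of `J₄`, extended skew-adjointly. -/
def EE (a b : Fin 4) : Matrix (Fin 8) (Fin 8) ℤ := fun i j =>
  (if pp i = a then if pp j = b then 1 else 0 else 0) -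
    ss i * ss j * (if pp j = a then if pp i = b then 1 else 0 else 0)

def DD (a b : Fin 4) : Matrix (Fin 8) (Fin 8) ℤ := fun i j =>
  EE a b i j - if a = b then EE 3 3 i j else 0

def cZ (i j : Fin 7) : Matrix (Fin 8) (Fin 8) ℤ := JZ i * JZ j - JZ j * JZ i

def castM : Matrix (Fin 8) (Fin 8) ℤ →+* Matrix (Fin 8) (Fin 8) ℝ :=
  (Int.castRingHom ℝ).mapMatrix

set_option maxHeartbeats 4000000 in
lemma J_eq (k : Fin 7) : J k = castM (JZ k) := by
  fin_cases k <;> simp [_root_.J, castM, JZ, J1, J2, J3, J4, J5, J6, J7] <;>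
    ext a b <;> fin_cases a <;> fin_cases b <;> simp

lemma TT_lt : ∀ a b, ∀ t ∈ TT a b, t.2.1 < t.2.2 := by decide +kernel

lemma TT_sum : ∀ a b, 4 • DD a b = ((TT a b).map fun t => t.1 • cZ t.2.1 t.2.2).sum := by
  decide +kernel

lemma DD_comm : ∀ a b, DD a b * JZ 3 = JZ 3 * DD a b := by decide +kernel

lemma list_mem (l : List (ℤ × Fin 7 × Fin 7)) (h : ∀ t ∈ l, t.2.1 < t.2.2) :
    castM (l.map fun t => t.1 • cZ t.2.1 t.2.2).sum ∈ NN := by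
  induction l with
  | nil => simp
  | cons t l ih =>
    rw [List.map_cons, List.sum_cons, map_add]
    refine NN.add_mem ?_ (ih fun t ht => h t (List.mem_cons_of_mem _ ht))
    rw [map_zsmul]
    have hm : castM (cZ t.2.1 t.2.2) ∈ NN := by
      refine Submodule.subset_span ⟨t.2.1, t.2.2, h t List.mem_cons_self, ?_⟩
      simp only [cZ, map_sub, map_mul, J_eq]
    exact zsmul_mem hm _

lemma DD_mem (a b : Fin 4) : castM (DD a b) ∈ NN := by
  have h := list_mem _ (TT_lt a b)
  rw [← TT_sum, map_nsmul] at h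
  have h2 := NN.smul_mem (1 / 4 : ℝ) h
  rwa [← Nat.cast_smul_eq_nsmul ℝ, smul_smul,
    show (1 / 4 : ℝ) * ((4 : ℕ) : ℝ) = 1 by norm_num, one_smul] at h2

def BB (S : Fin 4 → Fin 4 → ℝ) : Matrix (Fin 8) (Fin 8) ℝ :=
  ∑ a, ∑ b, (S a b / 2) • castM (DD a b)

lemma BB_mem (S : Fin 4 → Fin 4 → ℝ) : BB S ∈ NN :=
  NN.sum_mem fun a _ => NN.sum_mem fun b _ => NN.smul_mem _ (DD_mem a b)

lemma BB_comm (S : Fin 4 → Fin 4 → ℝ) : BB S * J4 - J4 * BB S = 0 := by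
  have h4 : J4 = castM (JZ 3) := J_eq 3
  have h : ∀ a b, castM (DD a b) * castM (JZ 3) = castM (JZ 3) * castM (DD a b) := by
    intro a b
    rw [← map_mul, ← map_mul, DD_comm]
  rw [sub_eq_zero, BB, h4]
  simp only [Finset.sum_mul, Finset.mul_sum, smul_mul_assoc, mul_smul_comm, h]

lemma BB_apply (S : Fin 4 → Fin 4 → ℝ) (h : ∑ a, S a a = 0) (i j : Fin 8) :
    BB S i j = (S (pp i) (pp j) - ss i * ss j * S (pp j) (pp i)) / 2 := by
  have h1 : BB S i j = ∑ a, ∑ b, S a b / 2 * ((EE a b i j : ℝ) - if a = b then (EE 3 3 i j : ℝ) else 0) := by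
    simp [BB, Matrix.sum_apply, castM, DD, apply_ite (Int.cast : ℤ → ℝ)]
  have h2 : ∑ a, S a a / 2 * (EE 3 3 i j : ℝ) = 0 := by
    rw [← Finset.sum_mul, ← Finset.sum_div, h]; simp
  rw [h1]
  simp only [mul_sub, Finset.sum_sub_distrib, mul_ite, mul_zero, Finset.sum_ite_eq, Finset.mem_univ, if_true, h2]
  simp [EE, mul_sub, Finset.sum_sub_distrib, apply_ite (Int.cast : ℤ → ℝ)]
  ring

lemma key (Y : Fin 8 → ℝ) (u v : Fin 4 → ℝ)
    (hu : u = ![Y 0 + Y 4, Y 1 + Y 7, Y 2 + Y 6, Y 3 + Y 5])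
    (hv : v = ![Y 0 - Y 4, Y 1 - Y 7, Y 2 - Y 6, Y 3 - Y 5])
    (S : Fin 4 → Fin 4 → ℝ) (h : ∑ a, S a a = 0)
    (h1 : ∀ a, ∑ b, S a b * u b = u a) (h2 : ∀ a, ∑ b, S b a * v b = v a) :
    ∃ B ∈ NN, B * J4 - J4 * B = 0 ∧ B.mulVec Y = J4.mulVec Y := by
  refine ⟨BB S, BB_mem S, BB_comm S, ?_⟩
  · subst hu hv
    have a0 := h1 0
    have a1 := h1 1
    have a2 := h1 2
    have a3 := h1 3
    have b0 := h2 0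
    have b1 := h2 1
    have b2 := h2 2
    have b3 := h2 3
    simp [Fin.sum_univ_four] at a0 a1 a2 a3 b0 b1 b2 b3
    ext i
    fin_cases i <;> simp [BB_apply S h, pp, ss, J4, Matrix.mulVec, dotProduct, Fin.sum_univ_eight] <;> linarith

lemma solve (u v : Fin 4 → ℝ) : ∃ S : Fin 4 → Fin 4 → ℝ, ∑ a, S a a = 0 ∧
    (∀ a, ∑ b, S a b * u b = u a) ∧ (∀ a, ∑ b, S b a * v b = v a) := by
  have one : ∀ u v : Fin 4 → ℝ, ∀ d : ℝ, d = u 0 * v 0 + u 1 * v 1 + u 2 * v 2 + u 3 * v 3 →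
      d ≠ 0 → ∃ S : Fin 4 → Fin 4 → ℝ, ∑ a, S a a = 0 ∧
      (∀ a, ∑ b, S a b * u b = u a) ∧ (∀ a, ∑ b, S b a * v b = v a) := by
    intro u v d hd h0
    refine ⟨fun a b => 4 / 3 * (u a * v b / d) - if a = b then 1 / 3 else 0, ?_, ?_, ?_⟩
    · simp [Fin.sum_univ_four]; field_simp; linarith
    · intro a
      fin_cases a <;> simp [Fin.sum_univ_four] <;> field_simp <;> rw [hd] <;> ring
    · intro a
      fin_cases a <;> simp [Fin.sum_univ_four] <;> field_simp <;> rw [hd] <;> ring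
  have pos : ∀ u : Fin 4 → ℝ, u ≠ 0 → u 0 * u 0 + u 1 * u 1 + u 2 * u 2 + u 3 * u 3 ≠ 0 := by
    intro u hu h
    apply hu
    ext i
    have : u i * u i ≤ 0 := by
      fin_cases i <;> simp <;>
        nlinarith [mul_self_nonneg (u 0), mul_self_nonneg (u 1), mul_self_nonneg (u 2), mul_self_nonneg (u 3)]
    simpa using mul_self_eq_zero.mp (le_antisymm this (mul_self_nonneg _))
  by_cases hu : u = 0
  · by_cases hv : v = 0
    · exact ⟨0, by simp [hu, hv]⟩
    · obtain ⟨S, h, _, h2⟩ := one v v _ rfl (pos v hv)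
      exact ⟨S, h, by simp [hu], h2⟩
  by_cases hv : v = 0
  · obtain ⟨S, h, h1, _⟩ := one u u _ rfl (pos u hu)
    exact ⟨S, h, h1, by simp [hv]⟩
  by_cases hd : u 0 * v 0 + u 1 * v 1 + u 2 * v 2 + u 3 * v 3 = 0
  · obtain ⟨p, hp⟩ : ∃ p, p = u 0 * u 0 + u 1 * u 1 + u 2 * u 2 + u 3 * u 3 := ⟨_, rfl⟩
    obtain ⟨q, hq⟩ : ∃ q, q = v 0 * v 0 + v 1 * v 1 + v 2 * v 2 + v 3 * v 3 := ⟨_, rfl⟩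
    have hp0 : p ≠ 0 := hp ▸ pos u hu
    have hq0 : q ≠ 0 := hq ▸ pos v hv
    have ep : (u 0 * u 0 + u 1 * u 1 + u 2 * u 2 + u 3 * u 3) / p = 1 := by
      rw [← hp]; exact div_self hp0
    have eq : (v 0 * v 0 + v 1 * v 1 + v 2 * v 2 + v 3 * v 3) / q = 1 := by
      rw [← hq]; exact div_self hq0
    refine ⟨fun a b => 2 * (u a * u b / p) + 2 * (v a * v b / q) - if a = b then 1 else 0, ?_, ?_, ?_⟩
    · simp [Fin.sum_univ_four]; linear_combination 2 * ep + 2 * eq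
    · intro a
      fin_cases a <;> simp [Fin.sum_univ_four]
      · linear_combination 2 * u 0 * ep + 2 * v 0 / q * hd
      · linear_combination 2 * u 1 * ep + 2 * v 1 / q * hd
      · linear_combination 2 * u 2 * ep + 2 * v 2 / q * hd
      · linear_combination 2 * u 3 * ep + 2 * v 3 / q * hd
    · intro a
      fin_cases a <;> simp [Fin.sum_univ_four]
      · linear_combination 2 * v 0 * eq + 2 * u 0 / p * hd
      · linear_combination 2 * v 1 * eq + 2 * u 1 / p * hd
      · linear_combination 2 * v 2 * eq + 2 * u 2 / p * hd
      · linear_combination 2 * v 3 * eq + 2 * u 3 / p * hd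
  · exact one u v _ rfl hd

/-- For every `Y ∈ ℝ⁸` there is `B ∈ N = span{[Jᵢ,Jⱼ] : 1 ≤ i < j ≤ 7}` with
`[B, J₄] = 0` and `B·Y = J₄·Y`. -/
theorem statement2 :
    ∀ Y : Fin 8 → ℝ,
      ∃ B ∈ NN, B * J4 - J4 * B = 0 ∧ B.mulVec Y = J4.mulVec Y := by
  intro Y
  obtain ⟨S, h, h1, h2⟩ := solve ![Y 0 + Y 4, Y 1 + Y 7, Y 2 + Y 6, Y 3 + Y 5]
    ![Y 0 - Y 4, Y 1 - Y 7, Y 2 - Y 6, Y 3 - Y 5]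
  exact key Y _ _ rfl rfl S h h1 h2

end
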